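/- arXiv:0902.0623 — 2 statements merged into one kernel-verified Lean document; each statement's English description precedes it below -/
import Mathlib

section
/- Let B have n atoms and let A be a Boolean subalgebra of B, regarded as an element of 𝒜. Then μ(A, B) = (−1)^{n + w(A)} · ∏_{c an atom of A} (|c| − 1)!, where μ is the Möbius function of the finite lattice 𝒜, w(A) is the number of atoms of A, and |c| is the number of atoms of B below c. (The sign exponent n + w(A) has the same parity as w(A) − n.) -/
open scoped Classical

noncomputable section

/-- An implication sublattice of a Boolean algebra `B`: a nonempty subset closed under
the implication `x → y := xᶜ ⊔ y` and under meet. -/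
def IsImplSublattice {B : Type*} [BooleanAlgebra B] (A : Set B) : Prop :=
  A.Nonempty ∧ (∀ x ∈ A, ∀ y ∈ A, xᶜ ⊔ y ∈ A) ∧ (∀ x ∈ A, ∀ y ∈ A, x ⊓ y ∈ A)

/-- A Boolean subalgebra of `B`: a subset containing `⊥` and `⊤`, closed under
join, meet and complement. -/
def IsBoolSubalgebra {B : Type*} [BooleanAlgebra B] (C : Set B) : Prop :=
  (⊥ : B) ∈ C ∧ (⊤ : B) ∈ C ∧ (∀ x ∈ C, ∀ y ∈ C, x ⊔ y ∈ C) ∧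
    (∀ x ∈ C, ∀ y ∈ C, x ⊓ y ∈ C) ∧ (∀ x ∈ C, xᶜ ∈ C)

/-- The lattice `𝒜` of implication sublattices of `B`, ordered by inclusion. -/
abbrev ImplLat (B : Type*) [BooleanAlgebra B] : Type _ := {A : Set B // IsImplSublattice A}

/-- Any finite preorder is locally finite. -/
instance (priority := 100) fintypeLocallyFinite {X : Type*} [Fintype X] [Preorder X] :
    LocallyFiniteOrder X :=
  Fintype.toLocallyFiniteOrder

lemma isImplSublattice_univ {B : Type*} [BooleanAlgebra B] :
    IsImplSublattice (Set.univ : Set B) :=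
  ⟨⟨⊤, trivial⟩, fun _ _ _ _ => trivial, fun _ _ _ _ => trivial⟩

lemma isImplSublattice_Ici {B : Type*} [BooleanAlgebra B] (c : B) :
    IsImplSublattice (Set.Ici c) :=
  ⟨⟨c, le_refl c⟩, fun _ _ _ hy => le_sup_of_le_right hy, fun _ hx _ hy => le_inf hx hy⟩

lemma isImplSublattice_singleton_top {B : Type*} [BooleanAlgebra B] :
    IsImplSublattice ({⊤} : Set B) := by
  refine ⟨⟨⊤, rfl⟩, ?_, ?_⟩ <;> intro x hx y hy <;> simp_all

/-- `|x|`: the number of atoms of `B` lying below `x`. -/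
def natomsBelow {B : Type*} [BooleanAlgebra B] [Fintype B] (x : B) : ℕ :=
  (Finset.univ.filter fun c : B => IsAtom c ∧ c ≤ x).card

/-- The atoms of a Boolean subalgebra `C` of `B`: the minimal elements of `C \ {⊥}`. -/
def subAtoms {B : Type*} [BooleanAlgebra B] [Fintype B] (C : Set B) : Finset B :=
  Finset.univ.filter fun d : B => d ∈ C ∧ d ≠ ⊥ ∧ ∀ x ∈ C, x ≠ ⊥ → x ≤ d → x = d

/-- Every Boolean subalgebra of `B` is an implication sublattice of `B`. -/
lemma IsBoolSubalgebra.isImplSublattice {B : Type*} [BooleanAlgebra B] {A : Set B}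
    (h : IsBoolSubalgebra A) : IsImplSublattice A :=
  ⟨⟨⊤, h.2.1⟩, fun x hx y hy => h.2.2.1 _ (h.2.2.2.2 x hx) _ hy,
    fun x hx y hy => h.2.2.2.1 x hx y hy⟩

namespace Equiv.Perm

/-- A permutation is transitive if it has a single cycle. -/
def Transitive {X : Type*} (g : Perm X) : Prop := ∀ a b, g.SameCycle a b

theorem transitive_iff_cycleType {X : Type*} [Fintype X] [DecidableEq X]
    (hX : 2 ≤ Fintype.card X) (g : Perm X) :
    g.Transitive ↔ g.cycleType = {Fintype.card X} := by
  have : Nontrivial X := Fintype.one_lt_card_iff_nontrivial.1 hX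
  constructor
  · intro h
    have hon : g.IsCycleOn _root_.Set.univ := ⟨g.bijective.bijOn_univ, fun a _ b _ => h a b⟩
    have hs : g.support = Finset.univ := by
      ext a
      simpa using hon.apply_ne _root_.Set.nontrivial_univ (_root_.Set.mem_univ a)
    obtain ⟨a⟩ := (inferInstance : Nonempty X)
    have hc : g.IsCycle := ⟨a, by simpa using hs.ge (Finset.mem_univ a), fun b _ => h a b⟩
    rw [hc.cycleType, hs, Finset.card_univ]
  · intro h a b
    have hc : g.IsCycle := by
      rw [← card_cycleType_eq_one, h, Multiset.card_singleton]
    have hs : g.support = Finset.univ := by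
      rw [← Finset.card_eq_iff_eq_univ, ← sum_cycleType, h, Multiset.sum_singleton]
    exact hc.sameCycle (by simpa using hs.ge (Finset.mem_univ a))
      (by simpa using hs.ge (Finset.mem_univ b))

theorem sum_sign_transitive (X : Type*) [Fintype X] [DecidableEq X] [Nonempty X] :
    ∑ g : Perm X with g.Transitive, (sign g : ℤ) =
      (-1) ^ (Fintype.card X + 1) * ((Fintype.card X - 1).factorial : ℤ) := by
  rcases (Nat.one_le_iff_ne_zero.2 (Fintype.card_ne_zero (α := X))).eq_or_lt with h1 | h2
  · have : Subsingleton X := Fintype.card_le_one_iff_subsingleton.1 h1.ge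
    have hu : (Finset.univ.filter fun g : Perm X => g.Transitive) = {1} := by
      ext g
      simp only [Finset.mem_filter_univ, Finset.mem_singleton, Subsingleton.elim g 1, iff_true]
      intro a b
      rw [Subsingleton.elim a b]
    rw [hu, ← h1]
    simp
  · rw [Finset.filter_congr fun g _ => transitive_iff_cycleType h2 g]
    rw [Finset.sum_congr rfl (g := fun _ => (-1 : ℤ) ^ (Fintype.card X + 1)), Finset.sum_const,
      card_of_cycleType_singleton h2 le_rfl, nsmul_eq_mul, mul_comm]
    · simp
    · intro g hg
      rw [sign_of_cycleType, (Finset.mem_filter.1 hg).2]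
      simp

/-- Assemble permutations of the fibres of `f` into a permutation of the domain. -/
def ofFibers {X D : Type*} (f : X → D) : (∀ d, Perm {a // f a = d}) →* Perm X :=
  (Equiv.sigmaFiberEquiv f).permCongrHom.toMonoidHom.comp (sigmaCongrRightHom _)

theorem ofFibers_apply {X D : Type*} (f : X → D) (σ : ∀ d, Perm {a // f a = d}) (a : X) :
    ofFibers f σ a = σ (f a) ⟨a, rfl⟩ := rfl

theorem ofFibers_apply_coe {X D : Type*} (f : X → D) (σ : ∀ d, Perm {a // f a = d}) (d : D)
    (a : {a // f a = d}) : ofFibers f σ a = σ d a := by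
  obtain ⟨a, rfl⟩ := a
  rfl

theorem sign_ofFibers {X D : Type*} [Fintype X] [Fintype D] [DecidableEq X] [DecidableEq D]
    (f : X → D) (σ : ∀ d, Perm {a // f a = d}) :
    sign (ofFibers f σ) = ∏ d, sign (σ d) := by
  let φ : (∀ d, Perm {a // f a = d}) →* ℤˣ :=
    { toFun σ := ∏ d, sign (σ d)
      map_one' := by simp
      map_mul' σ τ := by simp [Finset.prod_mul_distrib] }
  have : sign.comp (ofFibers f) = φ := by
    refine MonoidHom.pi_ext fun d τ => ?_
    have h1 : ofFibers f (Pi.mulSingle d τ) = ofSubtype τ := by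
      ext a
      rw [ofFibers_apply]
      by_cases h : f a = d
      · subst h
        rw [ofSubtype_apply_of_mem τ rfl, Pi.mulSingle_eq_same]
      · rw [ofSubtype_apply_of_not_mem τ h, Pi.mulSingle_eq_of_ne h]
        rfl
    have h2 : φ (Pi.mulSingle d τ) = sign τ := by
      change ∏ e, sign (Pi.mulSingle (M := fun e => Perm {a // f a = e}) d τ e) = _
      rw [Finset.prod_eq_single d, Pi.mulSingle_eq_same]
      · intro e _ he
        rw [Pi.mulSingle_eq_of_ne he, sign_one]
      · simp
    rw [h2, MonoidHom.comp_apply, h1, sign_ofSubtype]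
  exact DFunLike.congr_fun this σ

theorem sum_sign_fibers {X D : Type*} [Fintype X] [Fintype D] [DecidableEq X] [DecidableEq D]
    (f : X → D) :
    ∑ g : Perm X with (∀ a, f (g a) = f a) ∧ ∀ a b, f a = f b → g.SameCycle a b, (sign g : ℤ) =
      ∏ d, ∑ σ : Perm {a // f a = d} with σ.Transitive, (sign σ : ℤ) := by
  rw [Finset.prod_univ_sum]
  symm
  refine Finset.sum_nbij (ofFibers f) ?_ ?_ ?_ ?_
  · intro σ hσ
    simp only [Fintype.mem_piFinset, Finset.mem_filter_univ] at hσ ⊢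
    refine ⟨fun a => (σ (f a) ⟨a, rfl⟩).2, fun a b hab => ?_⟩
    obtain ⟨k, hk⟩ := hσ (f b) ⟨a, hab⟩ ⟨b, rfl⟩
    refine ⟨k, ?_⟩
    rw [← map_zpow]
    exact (ofFibers_apply_coe f (σ ^ k) (f b) ⟨a, hab⟩).trans (congrArg Subtype.val hk)
  · intro σ _ τ _ h
    ext d a
    rw [← ofFibers_apply_coe, h, ofFibers_apply_coe]
  · intro g hg
    simp only [Finset.coe_filter, Finset.mem_univ, true_and, Set.mem_ofPred_eq] at hg
    refine ⟨fun d => g.subtypePerm fun a => by rw [hg.1 a], ?_, by ext a; rfl⟩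
    simp only [Finset.mem_coe, Fintype.mem_piFinset, Finset.mem_filter_univ]
    rintro d ⟨a, rfl⟩ ⟨b, hb⟩
    obtain ⟨k, hk⟩ := hg.2 a b hb.symm
    refine ⟨k, Subtype.ext ?_⟩
    rw [subtypePerm_zpow]
    exact hk
  · intro σ _
    rw [sign_ofFibers]
    push_cast
    rfl

end Equiv.Perm

section Subalgebra

variable {B : Type*} [BooleanAlgebra B]

theorem atom_le_sup_iff {a x y : B} (ha : IsAtom a) : a ≤ x ⊔ y ↔ a ≤ x ∨ a ≤ y := by
  refine ⟨fun h => or_iff_not_imp_left.2 fun hx => ?_,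
    fun h => h.elim le_sup_of_le_left le_sup_of_le_right⟩
  exact (ha.not_le_iff_disjoint.1 hx).left_le_of_le_sup_left h

theorem atom_le_compl_iff {a x : B} (ha : IsAtom a) : a ≤ xᶜ ↔ ¬ a ≤ x := by
  rw [ha.not_le_iff_disjoint, le_compl_iff_disjoint_right]

theorem atom_le_finsetSup_iff {ι : Type*} {a : B} (ha : IsAtom a) (s : Finset ι) (f : ι → B) :
    a ≤ s.sup f ↔ ∃ i ∈ s, a ≤ f i := by
  induction s using Finset.induction_on with
  | empty => simpa using ha.ne_bot
  | insert i s _ ih => rw [Finset.sup_insert, atom_le_sup_iff ha, ih]; simp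

theorem IsImplSublattice.isBoolSubalgebra {A : Set B} (h : IsImplSublattice A)
    (h0 : (⊥ : B) ∈ A) : IsBoolSubalgebra A := by
  have hc : ∀ x ∈ A, xᶜ ∈ A := fun x hx => by simpa using h.2.1 x hx ⊥ h0
  refine ⟨h0, by simpa using hc ⊥ h0, fun x hx y hy => ?_, h.2.2, hc⟩
  simpa using h.2.1 _ (hc x hx) y hy

/-- The elements of `B` fixed by a permutation of the atoms of `B`. -/
def fixedSet (g : Equiv.Perm {c : B // IsAtom c}) : Set B :=
  {x | ∀ a, (g a : B) ≤ x ↔ (a : B) ≤ x}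

theorem isBoolSubalgebra_fixedSet (g : Equiv.Perm {c : B // IsAtom c}) :
    IsBoolSubalgebra (fixedSet g) := by
  refine ⟨fun a => ?_, fun a => by simp, fun x hx y hy a => ?_, fun x hx y hy a => ?_,
    fun x hx a => ?_⟩
  · simp [(g a).2.ne_bot, a.2.ne_bot]
  · rw [atom_le_sup_iff (g a).2, atom_le_sup_iff a.2, hx a, hy a]
  · rw [le_inf_iff, le_inf_iff, hx a, hy a]
  · rw [atom_le_compl_iff (g a).2, atom_le_compl_iff a.2, hx a]

variable [Fintype B]

theorem le_of_forall_atom_le {x y : B} (h : ∀ a, IsAtom a → a ≤ x → a ≤ y) : x ≤ y := by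
  rw [← sdiff_eq_bot_iff]
  refine (eq_bot_or_exists_atom_le (x \ y)).resolve_right fun ⟨a, ha, hle⟩ => ?_
  rw [sdiff_eq, le_inf_iff, atom_le_compl_iff ha] at hle
  exact hle.2 (h a ha hle.1)

/-- The least element of `A` above `a`. -/
def block (A : Set B) (a : B) : B :=
  (Finset.univ.filter fun x => x ∈ A ∧ a ≤ x).inf id

theorem le_block (A : Set B) (a : B) : a ≤ block A a :=
  Finset.le_inf fun _ hx => (Finset.mem_filter.1 hx).2.2

theorem IsBoolSubalgebra.block_mem {A : Set B} (hA : IsBoolSubalgebra A) (a : B) :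
    block A a ∈ A :=
  Finset.inf_induction hA.2.1 hA.2.2.2.1 fun _ hx => (Finset.mem_filter.1 hx).2.1

theorem block_le_iff {A : Set B} {a x : B} (hx : x ∈ A) : block A a ≤ x ↔ a ≤ x :=
  ⟨(le_block A a).trans, fun h => Finset.inf_le (f := id) (by simp [hx, h])⟩

theorem IsBoolSubalgebra.block_eq_iff_le {A : Set B} (hA : IsBoolSubalgebra A) {a b : B}
    (ha : IsAtom a) (hb : IsAtom b) : block A a = block A b ↔ a ≤ block A b := by
  refine ⟨fun h => h ▸ le_block A a, fun h => le_antisymm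
    ((block_le_iff (hA.block_mem b)).2 h) ((block_le_iff (hA.block_mem a)).2 ?_)⟩
  by_contra hba
  rw [← atom_le_compl_iff hb, ← block_le_iff (hA.2.2.2.2 _ (hA.block_mem a))] at hba
  exact (atom_le_compl_iff ha).1 (h.trans hba) (le_block A a)

theorem IsBoolSubalgebra.block_mem_subAtoms {A : Set B} (hA : IsBoolSubalgebra A) {a : B}
    (ha : IsAtom a) : block A a ∈ subAtoms A := by
  refine Finset.mem_filter.2 ⟨Finset.mem_univ _, hA.block_mem a,
    ne_bot_of_le_ne_bot ha.ne_bot (le_block A a), fun x hx h0 hle => le_antisymm hle ?_⟩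
  obtain ⟨b, hb, hbx⟩ := (eq_bot_or_exists_atom_le x).resolve_left h0
  rw [← (hA.block_eq_iff_le hb ha).2 (hbx.trans hle)]
  exact (block_le_iff hx).2 hbx

theorem IsBoolSubalgebra.block_eq_iff_of_mem_subAtoms {A : Set B} (hA : IsBoolSubalgebra A) {a d : B}
    (ha : IsAtom a) (hd : d ∈ subAtoms A) : block A a = d ↔ a ≤ d := by
  obtain ⟨-, hdA, -, hd⟩ := Finset.mem_filter.1 hd
  refine ⟨fun h => h ▸ le_block A a, fun h => ?_⟩
  exact hd _ (hA.block_mem a) (ne_bot_of_le_ne_bot ha.ne_bot (le_block A a))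
    ((block_le_iff hdA).2 h)

theorem IsBoolSubalgebra.mem_of_block_le {A : Set B} (hA : IsBoolSubalgebra A) {x : B}
    (h : ∀ a, IsAtom a → a ≤ x → block A a ≤ x) : x ∈ A := by
  have hx : x = (Finset.univ.filter fun a => IsAtom a ∧ a ≤ x).sup (block A) := by
    refine le_antisymm (le_of_forall_atom_le fun a ha hax => ?_)
      (Finset.sup_le fun a ha => h a (Finset.mem_filter.1 ha).2.1 (Finset.mem_filter.1 ha).2.2)
    exact (le_block A a).trans (Finset.le_sup (f := block A) (by simp [ha, hax]))
  rw [hx]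
  exact Finset.sup_induction hA.1 hA.2.2.1 fun a _ => hA.block_mem a

/-- The atom of `A` above an atom of `B`. -/
def IsBoolSubalgebra.atomBlock {A : Set B} (hA : IsBoolSubalgebra A) (a : {c : B // IsAtom c}) :
    {d // d ∈ subAtoms A} :=
  ⟨block A a, hA.block_mem_subAtoms a.2⟩

theorem IsBoolSubalgebra.atomBlock_eq_iff {A : Set B} (hA : IsBoolSubalgebra A)
    {a b : {c : B // IsAtom c}} :
    hA.atomBlock a = hA.atomBlock b ↔ ∀ x ∈ A, (a : B) ≤ x ↔ (b : B) ≤ x := by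
  rw [Subtype.ext_iff]
  change block A a = block A b ↔ _
  refine ⟨fun h x hx => ?_, fun h => (hA.block_eq_iff_le a.2 b.2).2 ?_⟩
  · rw [← block_le_iff hx, h, block_le_iff hx]
  · exact (h _ (hA.block_mem b)).2 (le_block A b)

theorem IsBoolSubalgebra.subset_fixedSet_iff {A : Set B} (hA : IsBoolSubalgebra A)
    (g : Equiv.Perm {c : B // IsAtom c}) :
    A ⊆ fixedSet g ↔ ∀ a, hA.atomBlock (g a) = hA.atomBlock a := by
  simp_rw [hA.atomBlock_eq_iff]
  exact ⟨fun h a x hx => h hx a, fun h x hx a => h a x hx⟩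

theorem IsBoolSubalgebra.fixedSet_eq_iff {A : Set B} (hA : IsBoolSubalgebra A)
    (g : Equiv.Perm {c : B // IsAtom c}) :
    fixedSet g = A ↔ (∀ a, hA.atomBlock (g a) = hA.atomBlock a) ∧
      ∀ a b, hA.atomBlock a = hA.atomBlock b → g.SameCycle a b := by
  rw [← hA.subset_fixedSet_iff, Set.Subset.antisymm_iff, and_comm]
  refine and_congr_right fun hsub => ⟨fun h a b hab => ?_, fun h x hx => ?_⟩
  · let x : B := (Finset.univ.filter fun c => g.SameCycle a c).sup Subtype.val
    have hx : ∀ c : {c : B // IsAtom c}, (c : B) ≤ x ↔ g.SameCycle a c := by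
      intro c
      rw [atom_le_finsetSup_iff c.2]
      refine ⟨fun ⟨d, hd, hcd⟩ => ?_, fun hc => ⟨c, by simpa using hc, le_rfl⟩⟩
      have : c = d := Subtype.ext ((d.2.le_iff_eq c.2.ne_bot).1 hcd)
      simpa [this] using hd
    have hxA : x ∈ A := h fun c => by rw [hx, hx, Equiv.Perm.sameCycle_apply_right]
    exact (hx b).1 ((hA.atomBlock_eq_iff.1 hab x hxA).1 ((hx a).2 (.refl g a)))
  · refine hA.mem_of_block_le fun a ha hax => le_of_forall_atom_le fun b hb hba => ?_
    obtain ⟨k, hk⟩ := h ⟨a, ha⟩ ⟨b, hb⟩ (Subtype.ext ((hA.block_eq_iff_le hb ha).2 hba).symm)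
    have hpow : ∀ (k : ℤ) (c : {c : B // IsAtom c}), ((g ^ k) c : B) ≤ x ↔ (c : B) ≤ x := by
      intro k
      induction k with
      | zero => simp
      | succ k ih => intro c; rw [zpow_add_one, Equiv.Perm.mul_apply, ih, hx c]
      | pred k ih =>
        intro c
        rw [zpow_sub_one, Equiv.Perm.mul_apply, ih, ← hx, ← Equiv.Perm.mul_apply, mul_inv_cancel,
          Equiv.Perm.one_apply]
    have := (hpow k ⟨a, ha⟩).2 hax
    rwa [hk] at this

theorem IsBoolSubalgebra.sum_sign_subset_fixedSet {A : Set B} (hA : IsBoolSubalgebra A) :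
    ∑ g : Equiv.Perm {c : B // IsAtom c} with A ⊆ fixedSet g, (Equiv.Perm.sign g : ℤ) =
      if A = Set.univ then 1 else 0 := by
  split_ifs with h
  · have : (Finset.univ.filter fun g : Equiv.Perm {c : B // IsAtom c} => A ⊆ fixedSet g) =
        {1} := by
      ext g
      simp only [Finset.mem_filter_univ, Finset.mem_singleton, h]
      constructor
      · intro hg
        ext a
        exact (a.2.le_iff_eq (g a).2.ne_bot).1 ((hg (Set.mem_univ (a : B)) a).2 le_rfl)
      · rintro rfl x _ a
        rfl
    rw [this]
    simp
  · obtain ⟨a, b, hab, hne⟩ : ∃ a b, hA.atomBlock a = hA.atomBlock b ∧ a ≠ b := by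
      by_contra! hinj
      refine h (Set.eq_univ_of_forall fun x => hA.mem_of_block_le fun a ha hax =>
        le_of_forall_atom_le fun b hb hba => ?_)
      have := hinj ⟨b, hb⟩ ⟨a, ha⟩ (Subtype.ext ((hA.block_eq_iff_le hb ha).2 hba))
      rwa [show b = a from congrArg Subtype.val this]
    have hswap : ∀ c, hA.atomBlock (Equiv.swap a b c) = hA.atomBlock c := by
      intro c
      rw [Equiv.swap_apply_def]
      split_ifs with h1 h2
      · rw [h1, hab]
      · rw [h2, hab]
      · rfl
    refine Finset.sum_involution (fun g _ => Equiv.swap a b * g) ?_ ?_ ?_ ?_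
    · intro g _
      simp [Equiv.Perm.sign_swap hne]
    · intro g _ _ hg
      exact hne (Equiv.swap_eq_one_iff.1 (mul_eq_right.1 hg))
    · intro g hg
      rw [Finset.mem_filter_univ, hA.subset_fixedSet_iff] at hg ⊢
      intro c
      rw [Equiv.Perm.mul_apply, hswap, hg]
    · intro g _
      simp [← mul_assoc]

theorem natomsBelow_eq_card (d : B) :
    natomsBelow d = (Finset.univ.filter fun a : {c : B // IsAtom c} => (a : B) ≤ d).card := by
  rw [natomsBelow, ← Finset.filter_filter, ← Finset.card_map (Function.Embedding.subtype IsAtom)]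
  congr 1
  ext c
  simp [and_comm]

theorem IsBoolSubalgebra.card_fiber_atomBlock {A : Set B} (hA : IsBoolSubalgebra A)
    (d : {d // d ∈ subAtoms A}) : Fintype.card {a // hA.atomBlock a = d} = natomsBelow (d : B) := by
  rw [natomsBelow_eq_card, Fintype.card_subtype]
  congr 1
  ext a
  simp only [Finset.mem_filter_univ, Subtype.ext_iff]
  exact hA.block_eq_iff_of_mem_subAtoms a.2 d.2

theorem IsBoolSubalgebra.sum_sign_fixedSet_eq {A : Set B} (hA : IsBoolSubalgebra A) :
    ∑ g : Equiv.Perm {c : B // IsAtom c} with fixedSet g = A, (Equiv.Perm.sign g : ℤ) =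
      (-1 : ℤ) ^ ((Finset.univ.filter fun c : B => IsAtom c).card + (subAtoms A).card) *
        ∏ c ∈ subAtoms A, ((natomsBelow c - 1).factorial : ℤ) := by
  rw [Finset.filter_congr fun g _ => hA.fixedSet_eq_iff g, Equiv.Perm.sum_sign_fibers]
  have hcard : ∑ d : {d // d ∈ subAtoms A}, natomsBelow (d : B) =
      (Finset.univ.filter fun c : B => IsAtom c).card := by
    simp_rw [← hA.card_fiber_atomBlock]
    rw [← Fintype.card_sigma, Fintype.card_congr (Equiv.sigmaFiberEquiv _), Fintype.card_subtype]
  have hterm : ∀ d : {d // d ∈ subAtoms A},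
      ∑ σ : Equiv.Perm {a // hA.atomBlock a = d} with σ.Transitive, (Equiv.Perm.sign σ : ℤ) =
        (-1) ^ (natomsBelow (d : B) + 1) * ((natomsBelow (d : B) - 1).factorial : ℤ) := by
    intro d
    obtain ⟨a, ha, had⟩ :=
      (eq_bot_or_exists_atom_le (d : B)).resolve_left (Finset.mem_filter.1 d.2).2.2.1
    have : Nonempty {a // hA.atomBlock a = d} :=
      ⟨⟨a, ha⟩, Subtype.ext ((hA.block_eq_iff_of_mem_subAtoms ha d.2).2 had)⟩
    rw [Equiv.Perm.sum_sign_transitive, hA.card_fiber_atomBlock]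
  rw [Finset.prod_congr rfl fun d _ => hterm d, Finset.prod_mul_distrib, Finset.prod_pow_eq_pow_sum,
    Finset.sum_add_distrib, hcard]
  congr 1
  · simp
  · exact Finset.prod_coe_sort (subAtoms A) fun c => ((natomsBelow c - 1).factorial : ℤ)

theorem mu_eq_sum_sign (A : ImplLat B) (hA : (⊥ : B) ∈ A.1) :
    IncidenceAlgebra.mu ℤ A ⟨Set.univ, isImplSublattice_univ⟩ =
      ∑ g : Equiv.Perm {c : B // IsAtom c} with fixedSet g = A.1, (Equiv.Perm.sign g : ℤ) := by
  let T : ImplLat B := ⟨Set.univ, isImplSublattice_univ⟩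
  let F : ImplLat B → ℤ := fun C =>
    ∑ g : Equiv.Perm {c : B // IsAtom c} with fixedSet g = C.1, (Equiv.Perm.sign g : ℤ)
  change IncidenceAlgebra.mu ℤ A T = F A
  have hT : ∀ C : ImplLat B, C ≤ T := fun C => Set.subset_univ C.1
  have hF : ∀ C : ImplLat B, (⊥ : B) ∈ C.1 →
      ∑ D ∈ Finset.Icc C T, F D = if C = T then 1 else 0 := by
    intro C hC
    have hsum := (C.2.isBoolSubalgebra hC).sum_sign_subset_fixedSet
    rw [if_congr (show C.1 = Set.univ ↔ C = T from (Subtype.ext_iff (a1 := C) (a2 := T)).symm)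
      rfl rfl] at hsum
    rw [← hsum]
    let φ : Equiv.Perm {c : B // IsAtom c} → ImplLat B := fun g =>
      ⟨fixedSet g, (isBoolSubalgebra_fixedSet g).isImplSublattice⟩
    rw [← Finset.sum_fiberwise_of_maps_to (s := Finset.univ.filter fun g => C.1 ⊆ fixedSet g)
      (t := Finset.Icc C T) (g := φ)
      (fun g hg => Finset.mem_Icc.2 ⟨(Finset.mem_filter.1 hg).2, hT _⟩)]
    refine Finset.sum_congr rfl fun D hD => Finset.sum_congr ?_ fun _ _ => rfl
    ext g
    simp only [Finset.mem_filter, Finset.mem_univ, true_and]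
    refine ⟨fun h => ⟨?_, Subtype.ext h⟩, fun h => congrArg Subtype.val h.2⟩
    rw [h]
    exact (Finset.mem_Icc.1 hD).1
  induction A using WellFoundedGT.induction with
  | ind A ih =>
    have h := (hF A hA).trans (IncidenceAlgebra.sum_Icc_mu_left (𝕜 := ℤ) A T).symm
    rw [← Finset.add_sum_Ioc_eq_sum_Icc (hT A), ← Finset.add_sum_Ioc_eq_sum_Icc (hT A)] at h
    rw [Finset.sum_congr rfl fun C hC => ih C (Finset.mem_Ioc.1 hC).1
      ((Finset.mem_Ioc.1 hC).1.le hA)] at h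
    exact (add_right_cancel h).symm

end Subalgebra

/-- Möbius function on the subalgebra lattice.  Let `B` have `n` atoms
and let `A` be a Boolean subalgebra of `B`.  Then
`μ(A, B) = (−1)^{n + w(A)} · ∏_{c an atom of A} (|c| − 1)!`, where `w(A)` is the number
of atoms of `A` and `|c|` the number of atoms of `B` below `c`. -/
theorem mu_boolSubalgebra_formula {B : Type*} [Fintype B] [BooleanAlgebra B] [Nontrivial B]
    (n : ℕ) (hn : n = (Finset.univ.filter fun c : B => IsAtom c).card)
    (A : Set B) (hA : IsBoolSubalgebra A) :
    IncidenceAlgebra.mu ℤ (⟨A, hA.isImplSublattice⟩ : ImplLat B)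
        ⟨Set.univ, isImplSublattice_univ⟩ =
      (-1 : ℤ) ^ (n + (subAtoms A).card) *
        ∏ c ∈ subAtoms A, ((natomsBelow c - 1).factorial : ℤ) := by
  subst hn
  rw [mu_eq_sum_sign _ hA.1]
  exact hA.sum_sign_fixedSet_eq
end
end

section
/- Let B have n ≥ 2 atoms. Then μ({1}, B) = (−1)^n · n!, where μ is the Möbius function of the finite lattice 𝒜, {1} is its least element and B its greatest element. -/
open scoped Classical

noncomputable section

namespace IsAtom

variable {B : Type*} [BooleanAlgebra B] {c : B}

lemma le_compl_iff_not_le (hc : IsAtom c) (x : B) : c ≤ xᶜ ↔ ¬ c ≤ x := by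
  rw [hc.not_le_iff_disjoint, le_compl_iff_disjoint_right]

lemma le_sup_iff_or (hc : IsAtom c) (x y : B) : c ≤ x ⊔ y ↔ c ≤ x ∨ c ≤ y := by
  refine ⟨fun h => ?_, fun h => h.elim le_sup_of_le_left le_sup_of_le_right⟩
  by_contra! hn
  exact hc.not_le_iff_disjoint.2 ((hc.not_le_iff_disjoint.1 hn.1).sup_right
    (hc.not_le_iff_disjoint.1 hn.2)) h

end IsAtom

section AtomColoring

variable {B : Type*} [BooleanAlgebra B]

lemma IsImplSublattice.top_mem {A : Set B} (hA : IsImplSublattice A) : ⊤ ∈ A := by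
  obtain ⟨x, hx⟩ := hA.1
  simpa using hA.2.1 x hx x hx

lemma IsImplSublattice.sup_mem {A : Set B} (hA : IsImplSublattice A) {x y : B}
    (hx : x ∈ A) (hy : y ∈ A) : x ⊔ y ∈ A := by
  have h := hA.2.1 _ (hA.2.1 x hx y hy) y hy
  rwa [compl_sup, compl_compl, sup_inf_right, compl_sup_eq_top, inf_top_eq] at h

/-- The elements of `B` whose set of atoms is a union of fibres of the partial colouring `f`
of the atoms and contains every uncoloured atom. -/
def coloringSublattice {K : Type*} (f : {c : B // IsAtom c} → Option K) : ImplLat B where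
  val := {b | (∀ c d, f c = f d → c.1 ≤ b → d.1 ≤ b) ∧ ∀ c, f c = none → c.1 ≤ b}
  property := by
    refine ⟨⟨⊤, by simp⟩, fun x hx y hy => ⟨fun c d hcd h => ?_, fun c hc => ?_⟩,
      fun x hx y hy => ⟨fun c d hcd h => ?_, fun c hc => le_inf (hx.2 c hc) (hy.2 c hc)⟩⟩
    · rw [c.2.le_sup_iff_or, c.2.le_compl_iff_not_le] at h
      rw [d.2.le_sup_iff_or, d.2.le_compl_iff_not_le]
      exact h.imp (fun h hd => h (hx.1 d c hcd.symm hd)) (hy.1 c d hcd)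
    · exact le_sup_of_le_right (hy.2 c hc)
    · rw [le_inf_iff] at h ⊢
      exact ⟨hx.1 c d hcd h.1, hy.1 c d hcd h.2⟩

lemma mem_coloringSublattice {K : Type*} {f : {c : B // IsAtom c} → Option K} {b : B} :
    b ∈ (coloringSublattice f).1 ↔
      (∀ c d, f c = f d → c.1 ≤ b → d.1 ≤ b) ∧ ∀ c, f c = none → c.1 ≤ b := Iff.rfl

lemma coloringSublattice_eq_univ_iff {K : Type*} (f : {c : B // IsAtom c} → Option K) :
    coloringSublattice f = ⟨Set.univ, isImplSublattice_univ⟩ ↔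
      Function.Injective f ∧ ∀ c, f c ≠ none := by
  rw [Subtype.ext_iff, Set.eq_univ_iff_forall]
  refine ⟨fun h => ⟨fun c d hcd => ?_, fun c hc => ?_⟩, fun h b => ?_⟩
  · have := (mem_coloringSublattice.1 (h c.1)).1 c d hcd le_rfl
    exact Subtype.ext ((c.2.le_iff_eq d.2.ne_bot).1 this).symm
  · exact c.2.ne_bot (le_bot_iff.1 ((mem_coloringSublattice.1 (h ⊥)).2 c hc))
  · refine mem_coloringSublattice.2 ⟨fun c d hcd hc => ?_, fun c hc => absurd hc (h.2 c)⟩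
    rwa [← h.1 hcd]

variable [Fintype B]

lemma exists_forall_atom_le_iff (p : {c : B // IsAtom c} → Prop) :
    ∃ b : B, ∀ c : {c : B // IsAtom c}, c.1 ≤ b ↔ p c := by
  refine ⟨(Finset.univ.filter p).sup Subtype.val, fun c => ⟨fun h => ?_, fun h => ?_⟩⟩
  · by_contra hc
    refine c.2.not_le_iff_disjoint.2 ?_ h
    rw [Finset.disjoint_sup_right]
    intro d hd
    refine c.2.disjoint_of_ne d.2 fun hcd => hc ?_
    rw [Subtype.ext hcd]
    exact (Finset.mem_filter.1 hd).2
  · exact Finset.le_sup (f := Subtype.val) (by simpa using h)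

/-- Membership in an implication sublattice can be tested by separating pairs of atoms. -/
lemma IsImplSublattice.mem_of_separated {A : Set B} (hA : IsImplSublattice A) {b : B}
    (hbot : ∀ d : B, IsAtom d → ¬ d ≤ b → ∃ x ∈ A, ¬ d ≤ x)
    (hsep : ∀ c d : B, IsAtom c → IsAtom d → c ≤ b → ¬ d ≤ b → ∃ x ∈ A, c ≤ x ∧ ¬ d ≤ x) :
    b ∈ A := by
  have hw : ∀ d : B, IsAtom d → ¬ d ≤ b → ∃ x ∈ A, b ≤ x ∧ ¬ d ≤ x := by
    intro d hd hdb
    have key : ∀ s : Finset B, (∀ c ∈ s, IsAtom c ∧ c ≤ b) →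
        ∃ x ∈ A, (∀ c ∈ s, c ≤ x) ∧ ¬ d ≤ x := by
      intro s
      induction s using Finset.induction_on with
      | empty => simpa using hbot d hd hdb
      | insert c s _ ih =>
        intro hs
        obtain ⟨x, hxA, hx, hdx⟩ := ih fun c hc => hs c (Finset.mem_insert_of_mem hc)
        obtain ⟨hc, hcb⟩ := hs c (Finset.mem_insert_self c s)
        obtain ⟨y, hyA, hcy, hdy⟩ := hsep c d hc hd hcb hdb
        refine ⟨x ⊔ y, hA.sup_mem hxA hyA, fun e he => ?_, ?_⟩
        · obtain rfl | he := Finset.mem_insert.1 he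
          · exact le_sup_of_le_right hcy
          · exact le_sup_of_le_left (hx e he)
        · rw [hd.le_sup_iff_or]
          tauto
    obtain ⟨x, hxA, hx, hdx⟩ := key (Finset.univ.filter fun c => IsAtom c ∧ c ≤ b) (by simp)
    refine ⟨x, hxA, ?_, hdx⟩
    rw [BooleanAlgebra.le_iff_atom_le_imp]
    exact fun c hc hcb => hx c (by simp [hc, hcb])
  have key : ∀ s : Finset B, (∀ d ∈ s, IsAtom d ∧ ¬ d ≤ b) →
      ∃ x ∈ A, b ≤ x ∧ ∀ d ∈ s, ¬ d ≤ x := by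
    intro s
    induction s using Finset.induction_on with
    | empty => exact fun _ => ⟨⊤, hA.top_mem, le_top, by simp⟩
    | insert d s _ ih =>
      intro hs
      obtain ⟨x, hxA, hx, hdx⟩ := ih fun c hc => hs c (Finset.mem_insert_of_mem hc)
      obtain ⟨hd, hdb⟩ := hs d (Finset.mem_insert_self d s)
      obtain ⟨y, hyA, hy, hdy⟩ := hw d hd hdb
      refine ⟨x ⊓ y, hA.2.2 x hxA y hyA, le_inf hx hy, fun e he h => ?_⟩
      rw [le_inf_iff] at h
      obtain rfl | he := Finset.mem_insert.1 he
      · exact hdy h.2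
      · exact hdx e he h.1
  obtain ⟨x, hxA, hx, hdx⟩ := key (Finset.univ.filter fun d => IsAtom d ∧ ¬ d ≤ b) (by simp)
  have hxb : x ≤ b := by
    rw [BooleanAlgebra.le_iff_atom_le_imp]
    intro d hd hdx'
    by_contra hdb
    exact hdx d (by simp [hd, hdb]) hdx'
  rwa [le_antisymm hx hxb]

lemma coloringSublattice_le_iff {K : Type*} (f : {c : B // IsAtom c} → Option K)
    (A : ImplLat B) :
    coloringSublattice f ≤ A ↔
      (∀ c d : {c : B // IsAtom c}, (∀ b ∈ A.1, c.1 ≤ b ↔ d.1 ≤ b) → f c = f d) ∧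
        ∀ c : {c : B // IsAtom c}, (∀ b ∈ A.1, c.1 ≤ b) → f c = none := by
  constructor
  · intro h
    have hmem : ∀ v : Option K, v ≠ none → ∀ b : B,
        (∀ e : {c : B // IsAtom c}, e.1 ≤ b ↔ f e ≠ v) → b ∈ A.1 := by
      intro v hv b hb
      refine h (mem_coloringSublattice.2 ⟨fun c d hcd hc => ?_, fun c hc => ?_⟩)
      · rw [hb] at hc ⊢
        rwa [← hcd]
      · rw [hb, hc]
        exact hv.symm
    refine ⟨fun c d hcd => ?_, fun c hc => ?_⟩
    · by_contra hne
      by_cases hc : f c = none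
      · obtain ⟨b, hb⟩ := exists_forall_atom_le_iff fun e => f e ≠ f d
        have hd : f d ≠ none := fun hd => hne (hc.trans hd.symm)
        exact (hb d).1 ((hcd b (hmem _ hd b hb)).1 ((hb c).2 hne)) rfl
      · obtain ⟨b, hb⟩ := exists_forall_atom_le_iff fun e => f e ≠ f c
        exact (hb c).1 ((hcd b (hmem _ hc b hb)).2 ((hb d).2 (Ne.symm hne))) rfl
    · by_contra hne
      obtain ⟨b, hb⟩ := exists_forall_atom_le_iff fun e => f e ≠ f c
      exact (hb c).1 (hc b (hmem _ hne b hb)) rfl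
  · rintro ⟨hconst, hnone⟩ b hb
    obtain ⟨hb₁, hb₂⟩ := mem_coloringSublattice.1 hb
    have hbot : ∀ d : B, IsAtom d → ¬ d ≤ b → ∃ x ∈ A.1, ¬ d ≤ x := by
      intro d hd hdb
      by_contra! hcon
      exact hdb (hb₂ ⟨d, hd⟩ (hnone ⟨d, hd⟩ hcon))
    refine A.2.mem_of_separated hbot fun c d hc hd hcb hdb => ?_
    obtain ⟨y, hyA, hdy⟩ := hbot d hd hdb
    by_contra! hcon
    refine hdb (hb₁ ⟨c, hc⟩ ⟨d, hd⟩ (hconst _ _ fun x hx => ⟨hcon x hx, fun hdx => ?_⟩) hcb)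
    by_contra hcx
    have := hcon _ (A.2.2.1 x hx y hyA) (le_sup_of_le_left ((hc.le_compl_iff_not_le x).2 hcx))
    rw [hd.le_sup_iff_or, hd.le_compl_iff_not_le] at this
    tauto

lemma card_coloringSublattice_eq_univ (k : ℕ) :
    Fintype.card {f : {c : B // IsAtom c} → Option (Fin k) //
      coloringSublattice f = ⟨Set.univ, isImplSublattice_univ⟩} =
        k.descFactorial (Fintype.card {c : B // IsAtom c}) := by
  rw [← Fintype.card_fin k, ← Fintype.card_embedding_eq, Fintype.card_fin]
  refine (Fintype.card_congr (Equiv.ofBijective (fun g => ⟨fun c => some (g c),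
    (coloringSublattice_eq_univ_iff _).2
      ⟨(Option.some_injective _).comp g.injective, by simp⟩⟩) ⟨?_, ?_⟩)).symm
  · intro g g' h
    ext c
    have := congrFun (congrArg Subtype.val h) c
    simpa using congrArg (Option.map Fin.val) this
  · rintro ⟨f, hf⟩
    obtain ⟨hinj, hne⟩ := (coloringSublattice_eq_univ_iff f).1 hf
    choose g hg using fun c => Option.ne_none_iff_exists'.1 (hne c)
    refine ⟨⟨g, fun c d hcd => hinj ?_⟩, Subtype.ext (funext fun c => (hg c).symm)⟩
    rw [hg, hg, hcd]

/-- Two atoms not below all of `A` are identified when `A` does not separate them. -/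
def atomSetoid (A : Set B) :
    Setoid {c : {c : B // IsAtom c} // ¬ ∀ b ∈ A, c.1 ≤ b} where
  r c d := ∀ b ∈ A, c.1.1 ≤ b ↔ d.1.1 ≤ b
  iseqv := ⟨fun _ _ _ => Iff.rfl, fun h b hb => (h b hb).symm,
    fun h h' b hb => (h b hb).trans (h' b hb)⟩

/-- The number of classes of atoms distinguished by `A`, not counting the atoms below all
of `A`. -/
def implRank (A : Set B) : ℕ := Fintype.card (Quotient (atomSetoid A))

lemma card_coloringSublattice_le (A : ImplLat B) (k : ℕ) :
    Fintype.card {f : {c : B // IsAtom c} → Option (Fin k) // coloringSublattice f ≤ A} =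
      (k + 1) ^ implRank A.1 := by
  have e : {f : {c : B // IsAtom c} → Option (Fin k) // coloringSublattice f ≤ A} ≃
      (Quotient (atomSetoid A.1) → Option (Fin k)) :=
    { toFun := fun f => Quotient.lift (fun c => f.1 c.1) fun c d h =>
        ((coloringSublattice_le_iff f.1 A).1 f.2).1 c.1 d.1 h
      invFun := fun g => ⟨fun c => if h : ∀ b ∈ A.1, c.1 ≤ b then none
          else g (Quotient.mk (atomSetoid A.1) ⟨c, h⟩), by
        rw [coloringSublattice_le_iff]
        refine ⟨fun c d hcd => ?_, fun c hc => dif_pos hc⟩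
        by_cases hc : ∀ b ∈ A.1, c.1 ≤ b
        · have hd : ∀ b ∈ A.1, d.1 ≤ b := fun b hb => (hcd b hb).1 (hc b hb)
          rw [dif_pos hc, dif_pos hd]
        · have hd : ¬ ∀ b ∈ A.1, d.1 ≤ b := fun hd => hc fun b hb => (hcd b hb).2 (hd b hb)
          rw [dif_neg hc, dif_neg hd]
          exact congrArg g (Quotient.sound (s := atomSetoid A.1) hcd)⟩
      left_inv := by
        rintro ⟨f, hf⟩
        ext1
        funext c
        by_cases hc : ∀ b ∈ A.1, c.1 ≤ b
        · exact (dif_pos hc).trans (((coloringSublattice_le_iff f A).1 hf).2 c hc).symm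
        · exact dif_neg hc
      right_inv := by
        intro g
        funext q
        induction q using Quotient.inductionOn with
        | h c => exact dif_neg c.2 }
  rw [Fintype.card_congr e, Fintype.card_fun, Fintype.card_option, Fintype.card_fin, implRank]

lemma implRank_eq_zero_iff (A : ImplLat B) :
    implRank A.1 = 0 ↔ A = ⟨{⊤}, isImplSublattice_singleton_top⟩ := by
  rw [implRank, Fintype.card_eq_zero_iff]
  constructor
  · intro h
    refine Subtype.ext (Set.eq_singleton_iff_unique_mem.2 ⟨A.2.top_mem, fun b hb => ?_⟩)
    rw [eq_top_iff, BooleanAlgebra.le_iff_atom_le_imp]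
    intro c hc _
    by_contra hcb
    exact h.false (Quotient.mk (atomSetoid A.1) ⟨⟨c, hc⟩, fun h => hcb (h b hb)⟩)
  · rintro rfl
    refine ⟨fun q => ?_⟩
    induction q using Quotient.inductionOn with
    | h c => exact c.2 (by simp)

lemma sum_mu_mul_implRank (k : ℕ) :
    ∑ A : ImplLat B, IncidenceAlgebra.mu ℤ A ⟨Set.univ, isImplSublattice_univ⟩ *
        ((k : ℤ) + 1) ^ implRank A.1 =
      k.descFactorial (Fintype.card {c : B // IsAtom c}) := by
  have hcard : ∀ A : ImplLat B, ((k : ℤ) + 1) ^ implRank A.1 =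
      ∑ f : {c : B // IsAtom c} → Option (Fin k),
        if coloringSublattice f ≤ A then 1 else 0 := by
    intro A
    rw [Finset.sum_boole, ← Fintype.card_subtype, card_coloringSublattice_le]
    push_cast
    rfl
  rw [← card_coloringSublattice_eq_univ, Fintype.card_subtype, ← Finset.sum_boole]
  simp_rw [hcard, Finset.mul_sum]
  rw [Finset.sum_comm]
  refine Finset.sum_congr rfl fun f _ => ?_
  rw [← IncidenceAlgebra.sum_Icc_mu_left (coloringSublattice f)]
  simp_rw [mul_ite, mul_one, mul_zero]
  rw [← Finset.sum_filter]
  refine Finset.sum_congr ?_ fun _ _ => rfl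
  ext A
  simp only [Finset.mem_filter, Finset.mem_univ, true_and, Finset.mem_Icc]
  exact ⟨fun h => ⟨h, Set.subset_univ _⟩, fun h => h.1⟩

open Polynomial in
lemma sum_mu_mul_X_add_one_pow_implRank :
    ∑ A : ImplLat B, C (IncidenceAlgebra.mu ℤ A ⟨Set.univ, isImplSublattice_univ⟩) *
        (X + 1) ^ implRank A.1 =
      descPochhammer ℤ (Fintype.card {c : B // IsAtom c}) := by
  refine eq_of_infinite_eval_eq _ _
    ((Set.infinite_range_of_injective (Nat.cast_injective (R := ℤ))).mono ?_)
  rintro _ ⟨k, rfl⟩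
  simp only [Set.mem_ofPred_eq, eval_finsetSum, eval_mul, eval_C, eval_pow, eval_add, eval_X,
    eval_one]
  rw [descPochhammer_eval_eq_descFactorial, sum_mu_mul_implRank]

end AtomColoring

/-- Let `B` have `n ≥ 2` atoms.  Then `μ({⊤}, B) = (−1)^n · n!`, where
`μ` is the Möbius function of the finite lattice `𝒜`, `{⊤}` its least element and `B`
its greatest element. -/
theorem mu_bot_top_eq_sign_factorial {B : Type*} [Fintype B] [BooleanAlgebra B]
    [Nontrivial B] (n : ℕ)
    (hn : n = (Finset.univ.filter fun c : B => IsAtom c).card) (hn2 : 2 ≤ n) :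
    IncidenceAlgebra.mu ℤ (⟨{⊤}, isImplSublattice_singleton_top⟩ : ImplLat B)
        ⟨Set.univ, isImplSublattice_univ⟩ =
      (-1 : ℤ) ^ n * n.factorial := by
  have h := congrArg (Polynomial.eval (-1)) (sum_mu_mul_X_add_one_pow_implRank (B := B))
  have hr := ascPochhammer_eval_neg_eq_descPochhammer ℤ (-1) n
  rw [neg_neg, ascPochhammer_eval_one] at hr
  rw [Fintype.card_subtype, ← hn] at h
  simp only [Polynomial.eval_finsetSum, Polynomial.eval_mul, Polynomial.eval_C,
    Polynomial.eval_pow, Polynomial.eval_add, Polynomial.eval_X, Polynomial.eval_one,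
    neg_add_cancel] at h
  rw [Finset.sum_eq_single ⟨{⊤}, isImplSublattice_singleton_top⟩] at h
  · rw [(implRank_eq_zero_iff _).2 rfl, pow_zero, mul_one] at h
    rw [h, hr, ← mul_assoc, ← mul_pow]
    simp
  · intro A _ hA
    rw [zero_pow (mt (implRank_eq_zero_iff A).1 hA), mul_zero]
  · simp
end
end
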